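/- Let G be a graph state on a graph G = (V,E). Measuring qubit v in the computational basis with outcome y ∈ {0,1} leaves the remaining qubits in the state (∏_{w : {v,w} ∈ E} Z_w^y) |Φ_{G−v}⟩, where G−v is the induced subgraph on V∖{v}. Consequently, for any connected graph G with at least 3 vertices, there exist vertices h, i, j ∈ V such that for every computational-basis outcome x on V∖{h,i,j}, the (unnormalized) post-measurement state ⟨x|_{V∖{h,i,j}} |Φ_G⟩ is locally Clifford equivalent to the three-qubit GHZ state. -/

import Mathlib

open scoped Classical
open Finset Matrix

/-- The single-qubit Pauli matrices I, X, Y, Z (indexed by 0,1,2,3). -/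
noncomputable def pauli2 (p : Fin 4) : Matrix Bool Bool ℂ :=
  if p = 0 then Matrix.of fun x y => if x = y then 1 else 0
  else if p = 1 then Matrix.of fun x y => if x = y then 0 else 1
  else if p = 2 then
    Matrix.of fun x y => if x = y then 0 else if x then Complex.I else -Complex.I
  else Matrix.of fun x y => if x = y then (if x then -1 else 1) else 0

/-- A single-qubit Clifford unitary: a unitary mapping every Pauli, under
conjugation, to a Pauli up to a phase in {1, −1, i, −i}. -/
noncomputable def IsOneQubitClifford (U : Matrix Bool Bool ℂ) : Prop :=
  U * Uᴴ = 1 ∧ Uᴴ * U = 1 ∧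
    ∀ p : Fin 4, ∃ ε ∈ ({1, -1, Complex.I, -Complex.I} : Set ℂ), ∃ q : Fin 4,
      U * pauli2 p * Uᴴ = ε • pauli2 q

/-- The (unnormalized) graph state of a graph G: amplitude (−1)^{#edges of G whose
two endpoints both carry the bit 1} on the computational basis state x. -/
noncomputable def graphState {V : Type*} [Fintype V] [DecidableEq V]
    (G : SimpleGraph V) (x : V → Bool) : ℂ :=
  (-1 : ℂ) ^ ((univ : Finset (Sym2 V)).filter
    (fun e => e ∈ G.edgeSet ∧ ∀ v ∈ e, x v = true)).card

/-- The (unnormalized) three-qubit GHZ state |000⟩ + |111⟩. -/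
noncomputable def ghz : Bool × Bool × Bool → ℂ :=
  fun w => if w.1 = w.2.1 ∧ w.2.1 = w.2.2 then 1 else 0

theorem IsOneQubitClifford.mul {U W : Matrix Bool Bool ℂ}
    (hU : IsOneQubitClifford U) (hW : IsOneQubitClifford W) : IsOneQubitClifford (U * W) := by
  obtain ⟨hU₁, hU₂, hU₃⟩ := hU
  obtain ⟨hW₁, hW₂, hW₃⟩ := hW
  refine ⟨?_, ?_, fun p => ?_⟩
  · rw [conjTranspose_mul, Matrix.mul_assoc, ← Matrix.mul_assoc W, hW₁, Matrix.one_mul, hU₁]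
  · rw [conjTranspose_mul, Matrix.mul_assoc, ← Matrix.mul_assoc Uᴴ, hU₂, Matrix.one_mul, hW₂]
  · obtain ⟨ε, hε, q, hq⟩ := hW₃ p
    obtain ⟨δ, hδ, r, hr⟩ := hU₃ q
    refine ⟨ε * δ, ?_, r, ?_⟩
    · simp only [Set.mem_insert_iff, Set.mem_singleton_iff] at hε hδ ⊢
      rcases hε with rfl | rfl | rfl | rfl <;> rcases hδ with rfl | rfl | rfl | rfl <;> simp
    · calc U * W * pauli2 p * (U * W)ᴴ = U * (W * pauli2 p * Wᴴ) * Uᴴ := by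
            simp only [conjTranspose_mul, Matrix.mul_assoc]
        _ = (ε * δ) • pauli2 r := by
            rw [hq, Matrix.mul_smul, Matrix.smul_mul, hr, smul_smul]

/-- The phase gate `diag(1, d)`. -/
noncomputable def phaseGate (d : ℂ) : Matrix Bool Bool ℂ :=
  Matrix.of fun x y => if x = y then (if x then d else 1) else 0

/-- The Hadamard gate. -/
noncomputable def hadamardGate : Matrix Bool Bool ℂ :=
  Matrix.of fun x y => ((√2)⁻¹ : ℝ) * (if x ∧ y then -1 else 1)

theorem inv_sqrt_two_mul_self : (((√2)⁻¹ : ℝ) : ℂ) * ((√2)⁻¹ : ℝ) = 1 / 2 := by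
  rw [← Complex.ofReal_mul, ← mul_inv, Real.mul_self_sqrt (by norm_num)]
  norm_num

theorem isOneQubitClifford_phaseGate_sign {d : ℂ} (hd : d = 1 ∨ d = -1) :
    IsOneQubitClifford (phaseGate d) := by
  refine ⟨?_, ?_, fun p => ?_⟩
  · rcases hd with rfl | rfl <;> ext a b <;> cases a <;> cases b <;>
      simp [phaseGate, Matrix.mul_apply]
  · rcases hd with rfl | rfl <;> ext a b <;> cases a <;> cases b <;>
      simp [phaseGate, Matrix.mul_apply]
  · refine ⟨if p = 1 ∨ p = 2 then d else 1, ?_, p, ?_⟩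
    · split_ifs <;> rcases hd with rfl | rfl <;> simp
    · rcases hd with rfl | rfl <;> fin_cases p <;> ext a b <;> cases a <;> cases b <;>
        simp [phaseGate, Matrix.mul_apply, pauli2]

theorem isOneQubitClifford_phaseGate_I : IsOneQubitClifford (phaseGate Complex.I) := by
  refine ⟨?_, ?_, fun p => ?_⟩
  · ext a b; cases a <;> cases b <;> simp [phaseGate, Matrix.mul_apply]
  · ext a b; cases a <;> cases b <;> simp [phaseGate, Matrix.mul_apply]
  · refine ⟨![1, 1, -1, 1] p, ?_, ![0, 2, 1, 3] p, ?_⟩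
    · fin_cases p <;> simp
    · fin_cases p <;> ext a b <;> cases a <;> cases b <;>
        simp [phaseGate, Matrix.mul_apply, pauli2]

theorem isOneQubitClifford_hadamardGate : IsOneQubitClifford hadamardGate := by
  have hr := inv_sqrt_two_mul_self
  refine ⟨?_, ?_, fun p => ?_⟩
  · ext a b; cases a <;> cases b <;>
      simp only [hadamardGate, Matrix.mul_apply, conjTranspose_apply, Matrix.of_apply,
        Fintype.sum_bool, star_mul', RCLike.star_def, Complex.conj_ofReal] <;>
      simp [-Complex.ofReal_inv] <;> linear_combination (2 : ℂ) * hr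
  · ext a b; cases a <;> cases b <;>
      simp only [hadamardGate, Matrix.mul_apply, conjTranspose_apply, Matrix.of_apply,
        Fintype.sum_bool, star_mul', RCLike.star_def, Complex.conj_ofReal] <;>
      simp [-Complex.ofReal_inv] <;> linear_combination (2 : ℂ) * hr
  · refine ⟨![1, 1, -1, 1] p, ?_, ![0, 3, 2, 1] p, ?_⟩
    · fin_cases p <;> simp
    · fin_cases p <;> ext a b <;> cases a <;> cases b <;>
        simp [-Complex.ofReal_inv, hadamardGate, Matrix.mul_apply, pauli2] <;>
        first
        | linear_combination (2 : ℂ) * hr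
        | linear_combination (-2 : ℂ) * hr
        | linear_combination (2 * Complex.I) * hr
        | linear_combination (-2 * Complex.I) * hr

theorem exists_clifford_ghz_path {α β γ k : ℂ} (hα : α = 1 ∨ α = -1) (hβ : β = 1 ∨ β = -1)
    (hγ : γ = 1 ∨ γ = -1) (hk : k ≠ 0) :
    ∃ Ch Ci Cj : Matrix Bool Bool ℂ,
      IsOneQubitClifford Ch ∧ IsOneQubitClifford Ci ∧ IsOneQubitClifford Cj ∧
      ∃ κ : ℂ, κ ≠ 0 ∧ ∀ w : Bool × Bool × Bool,
        (∑ a : Bool, ∑ b : Bool, ∑ c : Bool, Ch w.1 a * Ci w.2.1 b * Cj w.2.2 c *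
          (k * (if a then α else 1) * (if b then β else 1) * (if c then γ else 1) *
            (if a ∧ b then -1 else 1) * (if b ∧ c then -1 else 1))) = κ * ghz w := by
  have hr := inv_sqrt_two_mul_self
  refine ⟨hadamardGate * phaseGate α, phaseGate β, hadamardGate * phaseGate γ,
    isOneQubitClifford_hadamardGate.mul (isOneQubitClifford_phaseGate_sign hα),
    isOneQubitClifford_phaseGate_sign hβ,
    isOneQubitClifford_hadamardGate.mul (isOneQubitClifford_phaseGate_sign hγ),
    2 * k, by simpa using hk, ?_⟩
  rintro ⟨w₁, w₂, w₃⟩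
  rcases hα with rfl | rfl <;> rcases hβ with rfl | rfl <;> rcases hγ with rfl | rfl <;>
    cases w₁ <;> cases w₂ <;> cases w₃ <;>
    simp [-Complex.ofReal_inv, hadamardGate, phaseGate, Matrix.mul_apply, ghz] <;>
    first
    | ring1
    | linear_combination (4 * k) * hr

theorem exists_clifford_ghz_triangle {α β γ k : ℂ} (hα : α = 1 ∨ α = -1)
    (hβ : β = 1 ∨ β = -1) (hγ : γ = 1 ∨ γ = -1) (hk : k ≠ 0) :
    ∃ Ch Ci Cj : Matrix Bool Bool ℂ,
      IsOneQubitClifford Ch ∧ IsOneQubitClifford Ci ∧ IsOneQubitClifford Cj ∧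
      ∃ κ : ℂ, κ ≠ 0 ∧ ∀ w : Bool × Bool × Bool,
        (∑ a : Bool, ∑ b : Bool, ∑ c : Bool, Ch w.1 a * Ci w.2.1 b * Cj w.2.2 c *
          (k * (if a then α else 1) * (if b then β else 1) * (if c then γ else 1) *
            (if a ∧ b then -1 else 1) * (if b ∧ c then -1 else 1) *
            (if a ∧ c then -1 else 1))) = κ * ghz w := by
  have hs : (((√2)⁻¹ : ℝ) : ℂ) ≠ 0 := by simp
  have hd : ∀ {d : ℂ}, d = 1 ∨ d = -1 →
      IsOneQubitClifford (hadamardGate * (phaseGate Complex.I * phaseGate d)) := fun h =>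
    isOneQubitClifford_hadamardGate.mul
      (isOneQubitClifford_phaseGate_I.mul (isOneQubitClifford_phaseGate_sign h))
  have hI : (1 : ℂ) + Complex.I ≠ 0 := fun h => by simpa using congrArg Complex.re h
  refine ⟨phaseGate Complex.I * (hadamardGate * (phaseGate Complex.I * phaseGate α)),
    hadamardGate * (phaseGate Complex.I * phaseGate β),
    hadamardGate * (phaseGate Complex.I * phaseGate γ),
    isOneQubitClifford_phaseGate_I.mul (hd hα), hd hβ, hd hγ,
    4 * (1 + Complex.I) * (((√2)⁻¹ : ℝ) : ℂ) ^ 3 * k, by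
      refine mul_ne_zero (mul_ne_zero (mul_ne_zero (by norm_num) hI) (pow_ne_zero _ hs)) hk, ?_⟩
  generalize hr : (((√2)⁻¹ : ℝ) : ℂ) = r at *
  have hentry : ∀ x y, hadamardGate x y = r * (if x ∧ y then -1 else 1) := fun x y => by
    rw [← hr]; rfl
  have hrow : ∀ {d : ℂ}, d = 1 ∨ d = -1 → ∀ x y : Bool,
      (hadamardGate * (phaseGate Complex.I * phaseGate d)) x y * (if y then d else 1) =
        r * (if x ∧ y then -1 else 1) * (if y then Complex.I else 1) := by
    intro d h x y
    rcases h with rfl | rfl <;> cases x <;> cases y <;>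
      simp [hentry, phaseGate, Matrix.mul_apply]
  have hphase : ∀ (M : Matrix Bool Bool ℂ) (x y : Bool),
      (phaseGate Complex.I * M) x y = (if x then Complex.I else 1) * M x y := by
    intro M x y
    cases x <;> simp [phaseGate, Matrix.mul_apply]
  rintro ⟨w₁, w₂, w₃⟩
  have hterm : ∀ p q s t u l m n e : ℂ,
      p * q * s * (k * l * m * n * t * u * e) = k * (p * l) * (q * m) * (s * n) * t * u * e := by
    intros; ring
  simp only [hterm, hphase _ w₁, mul_assoc (if w₁ = true then Complex.I else 1), hrow hα,
    hrow hβ, hrow hγ]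
  cases w₁ <;> cases w₂ <;> cases w₃ <;> simp [ghz] <;> ring_nf <;>
    simp [Complex.I_sq, Complex.I_pow_three, Complex.I_pow_four] <;> ring

section GraphState

variable {V : Type*} [Fintype V] (G : SimpleGraph V)

/-- The sign `∏ (-1)^{x w}` over the neighbours `w` of `v`. -/
noncomputable def neighborSign (x : V → Bool) (v : V) : ℂ :=
  (-1) ^ ((univ : Finset V).filter (fun w => G.Adj v w ∧ x w = true)).card

theorem neighborSign_eq (x : V → Bool) (v : V) :
    neighborSign G x v = 1 ∨ neighborSign G x v = -1 :=
  neg_one_pow_eq_or ℂ _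

variable [DecidableEq V]

theorem graphState_ne_zero (x : V → Bool) : graphState G x ≠ 0 :=
  pow_ne_zero _ (by norm_num)

theorem graphState_update (x : V → Bool) (v : V) (y : Bool) :
    graphState G (Function.update x v y) =
      (if y then neighborSign G x v else 1) * graphState G (Function.update x v false) := by
  cases y
  · simp
  simp only [if_true, neighborSign, graphState, ← pow_add]
  congr 1
  have hinj : Set.InjOn (fun w => s(v, w))
      ((univ : Finset V).filter (fun w => G.Adj v w ∧ x w = true) : Set V) :=
    fun a _ b _ h => Sym2.congr_right.mp h
  rw [← card_image_of_injOn hinj, ← card_union_of_disjoint]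
  · congr 1
    ext e
    induction e using Sym2.ind with
    | _ a b =>
      simp only [mem_filter, mem_univ, true_and, mem_union, mem_image, SimpleGraph.mem_edgeSet,
        Sym2.mem_iff, forall_eq_or_imp, forall_eq, Sym2.eq_iff, Function.update_apply]
      by_cases ha : a = v <;> by_cases hb : b = v
      · subst ha; subst hb; simp
      · subst ha
        simp only [if_true, hb, if_false, Bool.false_eq_true, false_and, and_false, or_false,
          true_and]
        constructor
        · rintro ⟨h₁, h₂⟩; exact ⟨b, ⟨h₁, h₂⟩, .inl rfl⟩
        · rintro ⟨w, ⟨h₁, h₂⟩, rfl | ⟨h, rfl⟩⟩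
          · exact ⟨h₁, h₂⟩
          · exact absurd h.symm hb
      · subst hb
        simp only [if_true, ha, if_false, Bool.false_eq_true, and_false, or_false, and_true]
        constructor
        · rintro ⟨h₁, h₂⟩; exact ⟨a, ⟨h₁.symm, h₂⟩, .inr ⟨trivial, rfl⟩⟩
        · rintro ⟨w, ⟨h₁, h₂⟩, ⟨rfl, rfl⟩ | ⟨_, rfl⟩⟩
          · exact absurd rfl ha
          · exact ⟨h₁.symm, h₂⟩
      · simp only [ha, hb, if_false]
        constructor
        · exact .inr
        · rintro (⟨w, _, ⟨rfl, _⟩ | ⟨rfl, _⟩⟩ | h)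
          · exact absurd rfl ha
          · exact absurd rfl hb
          · exact h
  · rw [Finset.disjoint_left]
    intro e he he'
    obtain ⟨w, _, rfl⟩ := mem_image.mp he
    simpa using (mem_filter.mp he').2.2 v (Sym2.mem_mk_left v w)

theorem neighborSign_update (x : V → Bool) (v u : V) (y : Bool) (hx : x v = false) :
    neighborSign G (Function.update x v y) u =
      (if y ∧ G.Adj u v then -1 else 1) * neighborSign G x u := by
  cases y
  · rw [← hx, Function.update_eq_self]; simp [hx]
  by_cases h : G.Adj u v
  · simp only [h, and_true, if_true, neighborSign]
    rw [← pow_succ']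
    congr 1
    rw [← card_insert_of_notMem (a := v) (by simp [hx])]
    congr 1
    ext w
    by_cases hw : w = v
    · subst hw; simp [h]
    · simp [hw]
  · simp only [h, and_false, if_false, neighborSign, one_mul]
    congr 2
    ext w
    by_cases hw : w = v
    · subst hw; simp [h]
    · simp [hw]

theorem graphState_eq_graphState_induce (v : V) (x : V → Bool) (hx : x v = false) :
    graphState G x = graphState (G.induce {u : V | u ≠ v}) (fun u => x u.val) := by
  unfold graphState
  congr 1
  symm
  refine card_bij (fun e _ => e.map Subtype.val) ?_ ?_ ?_
  · intro e
    induction e using Sym2.ind with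
    | _ a b =>
      simp only [mem_filter, mem_univ, true_and, SimpleGraph.mem_edgeSet, Sym2.mem_iff,
        forall_eq_or_imp, forall_eq, Sym2.map_mk, SimpleGraph.comap_adj,
        Function.Embedding.subtype_apply]
      exact id
  · intro e _ e' _ h
    exact Sym2.map.injective Subtype.val_injective h
  · intro e
    induction e using Sym2.ind with
    | _ a b =>
      intro he
      simp only [mem_filter, mem_univ, true_and, SimpleGraph.mem_edgeSet, Sym2.mem_iff,
        forall_eq_or_imp, forall_eq] at he
      have hne : ∀ {u}, x u = true → u ≠ v := by
        rintro u hu rfl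
        simp [hx] at hu
      refine ⟨s(⟨a, hne he.2.1⟩, ⟨b, hne he.2.2⟩), ?_, rfl⟩
      simp only [mem_filter, mem_univ, true_and, SimpleGraph.mem_edgeSet, Sym2.mem_iff,
        forall_eq_or_imp, forall_eq]
      exact he

theorem graphState_update_three {h i j : V} (hhi : G.Adj i h) (hij : G.Adj i j) (hhj : h ≠ j)
    (x : V → Bool) (xh : x h = false) (xi : x i = false) (xj : x j = false) (a b c : Bool) :
    graphState G (Function.update (Function.update (Function.update x j c) i b) h a) =
      graphState G x * (if a then neighborSign G x h else 1) *
        (if b then neighborSign G x i else 1) * (if c then neighborSign G x j else 1) *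
        (if a ∧ b then -1 else 1) * (if b ∧ c then -1 else 1) *
        (if G.Adj h j ∧ a ∧ c then -1 else 1) := by
  have e₁ : Function.update (Function.update (Function.update x j c) i b) h false =
      Function.update (Function.update x j c) i b := by
    rw [Function.update_eq_self_iff]; simp [hhi.ne', hhj, xh]
  have e₂ : Function.update (Function.update x j c) i false = Function.update x j c := by
    rw [Function.update_eq_self_iff]; simp [hij.ne, xi]
  have e₃ : Function.update x j false = x := by
    rw [Function.update_eq_self_iff, xj]
  rw [graphState_update, e₁, graphState_update, e₂, graphState_update, e₃,
    neighborSign_update G _ i h b (by simp [hij.ne, xi]), neighborSign_update G _ j h c xj,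
    neighborSign_update G _ j i c xj]
  cases a <;> cases b <;> cases c <;> by_cases ht : G.Adj h j <;>
    simp [ht, hhi.symm, hij] <;> ring

end GraphState

theorem SimpleGraph.Connected.exists_two_neighbors {V : Type*} [Fintype V] {G : SimpleGraph V}
    (hconn : G.Connected) (hcard : 3 ≤ Fintype.card V) :
    ∃ h i j : V, G.Adj i h ∧ G.Adj i j ∧ h ≠ j := by
  have : Nontrivial V := Fintype.one_lt_card_iff_nontrivial.mp (by omega)
  obtain ⟨u⟩ := hconn.nonempty
  obtain ⟨v, huv⟩ := hconn.preconnected.exists_adj_of_nontrivial u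
  obtain ⟨w, hw⟩ : ∃ w, w ∉ ({u, v} : Finset V) := by
    by_contra! hall
    have := card_le_card (fun z _ => hall z : (univ : Finset V) ⊆ {u, v})
    have := card_le_two (a := u) (b := v)
    rw [card_univ] at *
    omega
  obtain ⟨p⟩ := hconn.preconnected u w
  obtain ⟨d, -, hd, hd'⟩ := p.exists_boundary_dart {u, v} (by simp) (by simpa using hw)
  simp only [Set.mem_insert_iff, Set.mem_singleton_iff, not_or] at hd hd'
  rcases hd with hd | hd
  · exact ⟨v, u, d.snd, huv, hd ▸ d.adj, Ne.symm hd'.2⟩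
  · exact ⟨u, v, d.snd, huv.symm, hd ▸ d.adj, Ne.symm hd'.1⟩

/-- (1) measuring qubit v of the graph state |Φ_G⟩ in the computational
basis with outcome y leaves the remaining qubits in the state
(∏_{w ∼ v} Z_w^y)|Φ_{G−v}⟩ (up to a nonzero scalar); (2) for every connected graph G on
at least 3 vertices there are vertices h, i, j such that for every computational-basis
outcome x on the remaining qubits the (unnormalized) post-measurement state
⟨x|_{V∖{h,i,j}}|Φ_G⟩ is locally Clifford equivalent to the GHZ state. -/
theorem stmt_12 {V : Type*} [Fintype V] [DecidableEq V] (G : SimpleGraph V)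
    (hconn : G.Connected) (hcard : 3 ≤ Fintype.card V) :
    (∀ (v : V) (y : Bool), ∃ c : ℂ, c ≠ 0 ∧
      ∀ x' : {u : V // u ≠ v} → Bool,
        graphState G (fun u => if h : u = v then y else x' ⟨u, h⟩) =
          c * (-1 : ℂ) ^ (if y then
              ((univ : Finset {u : V // u ≠ v}).filter
                (fun w => G.Adj v w.val ∧ x' w = true)).card else 0) *
            graphState (G.induce {u : V | u ≠ v}) (fun u => x' ⟨u.val, u.prop⟩)) ∧
    (∃ h i j : V, h ≠ i ∧ i ≠ j ∧ h ≠ j ∧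
      ∀ x : {u : V // u ≠ h ∧ u ≠ i ∧ u ≠ j} → Bool,
        ∃ Ch Ci Cj : Matrix Bool Bool ℂ,
          IsOneQubitClifford Ch ∧ IsOneQubitClifford Ci ∧ IsOneQubitClifford Cj ∧
          ∃ κ : ℂ, κ ≠ 0 ∧
            ∀ w : Bool × Bool × Bool,
              (∑ a : Bool, ∑ b : Bool, ∑ c : Bool,
                Ch w.1 a * Ci w.2.1 b * Cj w.2.2 c *
                  graphState G (fun u =>
                    if hh : u = h then a else if hi : u = i then b
                    else if hj : u = j then c else x ⟨u, ⟨hh, hi, hj⟩⟩)) =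
              κ * ghz w) := by
  refine ⟨fun v y => ⟨1, one_ne_zero, fun x' => ?_⟩, ?_⟩
  · set x : V → Bool := fun u => if h : u = v then false else x' ⟨u, h⟩ with hx
    have hxv : x v = false := by simp [hx]
    have hsub : ∀ u : {u : V // u ≠ v}, x u.val = x' u := fun u => by simp [hx, u.prop]
    have e₁ : (fun u => if h : u = v then y else x' ⟨u, h⟩) = Function.update x v y := by
      ext u
      by_cases hu : u = v
      · subst hu; simp
      · simp [hx, hu]
    have e₂ : Function.update x v false = x := by rw [Function.update_eq_self_iff, hxv]
    have e₃ : ((univ : Finset V).filter (fun w => G.Adj v w ∧ x w = true)).card =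
        ((univ : Finset {u : V // u ≠ v}).filter
          (fun w => G.Adj v w.val ∧ x' w = true)).card := by
      symm
      refine card_bij (fun w _ => w.val) ?_ (fun _ _ _ _ h => Subtype.ext h) ?_
      · intro w hw
        simpa [hsub] using hw
      · intro w hw
        rw [mem_filter] at hw
        refine ⟨⟨w, hw.2.1.ne'⟩, ?_, rfl⟩
        simpa [← hsub] using hw.2
    rw [e₁, graphState_update, e₂, graphState_eq_graphState_induce G v x hxv, neighborSign, e₃,
      one_mul]
    congr 1
    · cases y <;> simp
    · exact congrArg _ (funext fun u => hsub u)
  · obtain ⟨h, i, j, hih, hij, hhj⟩ := hconn.exists_two_neighbors hcard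
    refine ⟨h, i, j, hih.ne', hij.ne, hhj, fun x' => ?_⟩
    set x : V → Bool := fun u => if hh : u = h then false else if hi : u = i then false
      else if hj : u = j then false else x' ⟨u, ⟨hh, hi, hj⟩⟩ with hx
    have e : ∀ a b c : Bool, (fun u => if hh : u = h then a else if hi : u = i then b
        else if hj : u = j then c else x' ⟨u, ⟨hh, hi, hj⟩⟩) =
        Function.update (Function.update (Function.update x j c) i b) h a := by
      intro a b c
      ext u
      simp only [Function.update_apply, hx]
      split_ifs <;> rfl
    simp only [e, graphState_update_three G hih hij hhj x (by simp [hx]) (by simp [hx])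
      (by simp [hx])]
    have hs := neighborSign_eq G x
    by_cases ht : G.Adj h j
    · simpa only [ht, true_and] using
        exists_clifford_ghz_triangle (hs h) (hs i) (hs j) (graphState_ne_zero G x)
    · simpa only [ht, false_and, if_false, mul_one] using
        exists_clifford_ghz_path (hs h) (hs i) (hs j) (graphState_ne_zero G x)
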